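/- Let ε, ε₁ ∈ {1,−1}, a, b ∈ ℂ, and let p, q be twice-differentiable complex-valued functions of τ on a domain with τ ≠ 0, p(τ) ≠ 0, q(τ) ≠ 0, satisfying Hamilton's equations p' = −∂H_{ε₁}/∂q and q' = ∂H_{ε₁}/∂p for H_{ε₁}(p,q;τ) = p²q²/τ − 2ε₁ p q (ai + 1/2)/τ + 4εq + ibp + (ai + 1/2)²/(2τ). Then the function f(τ) := p(τ)q(τ)/2 satisfies the second-order ODE τ²(f'' + 4iεb)² = (4f − ε₁(2ia + 1))²((f')² + 8iεb f). -/

import Mathlib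

open Complex

/-- The Hamiltonian
`H_{ε₁}(p,q;τ) = p²q²/τ − 2ε₁pq(ai + 1/2)/τ + 4εq + ibp + (ai + 1/2)²/(2τ)`. -/
noncomputable def Ham (a b ε ε₁ : ℂ) (p q τ : ℂ) : ℂ :=
  p ^ 2 * q ^ 2 / τ - 2 * ε₁ * p * q * (a * Complex.I + 1 / 2) / τ
    + 4 * ε * q + Complex.I * b * p + (a * Complex.I + 1 / 2) ^ 2 / (2 * τ)

theorem hasDerivAt_Ham_fst (a b ε ε₁ P Q τ : ℂ) :
    HasDerivAt (fun P => Ham a b ε ε₁ P Q τ)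
      (2 * P * Q ^ 2 / τ - 2 * ε₁ * Q * (a * Complex.I + 1 / 2) / τ + Complex.I * b) P := by
  unfold Ham
  have h := hasDerivAt_id' P
  refine HasDerivAt.congr_deriv (((((((h.fun_pow 2).mul_const (Q ^ 2)).div_const τ).fun_sub
    ((((h.const_mul (2 * ε₁)).mul_const Q).mul_const (a * Complex.I + 1 / 2)).div_const τ)).add_const
    (4 * ε * Q)).fun_add (h.const_mul (Complex.I * b))).add_const
      ((a * Complex.I + 1 / 2) ^ 2 / (2 * τ))) ?_
  simp

theorem hasDerivAt_Ham_snd (a b ε ε₁ P Q τ : ℂ) :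
    HasDerivAt (fun Q => Ham a b ε ε₁ P Q τ)
      (2 * P ^ 2 * Q / τ - 2 * ε₁ * P * (a * Complex.I + 1 / 2) / τ + 4 * ε) Q := by
  unfold Ham
  have h := hasDerivAt_id' Q
  refine HasDerivAt.congr_deriv (((((((h.fun_pow 2).const_mul (P ^ 2)).div_const τ).fun_sub
    (((h.const_mul (2 * ε₁ * P)).mul_const (a * Complex.I + 1 / 2)).div_const τ)).fun_add
    (h.const_mul (4 * ε))).add_const (Complex.I * b * P)).add_const
      ((a * Complex.I + 1 / 2) ^ 2 / (2 * τ))) ?_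
  simp
  ring

/-- If `p, q` solve Hamilton's equations for `H_{ε₁}`, then `f := pq/2`
satisfies `τ²(f'' + 4iεb)² = (4f − ε₁(2ia + 1))²((f')² + 8iεbf)`. -/
theorem f_second_order_ode
    (S : Set ℂ) (hS : IsOpen S) (a b ε ε₁ : ℂ)
    (hε : ε = 1 ∨ ε = -1) (hε₁ : ε₁ = 1 ∨ ε₁ = -1)
    (p q : ℂ → ℂ)
    (hne : ∀ τ ∈ S, τ ≠ 0 ∧ p τ ≠ 0 ∧ q τ ≠ 0)
    (hp2 : ∀ τ ∈ S, DifferentiableAt ℂ (deriv p) τ)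
    (hq2 : ∀ τ ∈ S, DifferentiableAt ℂ (deriv q) τ)
    (hp : ∀ τ ∈ S,
      HasDerivAt p (-(deriv (fun Q => Ham a b ε ε₁ (p τ) Q τ) (q τ))) τ)
    (hq : ∀ τ ∈ S,
      HasDerivAt q (deriv (fun P => Ham a b ε ε₁ P (q τ) τ) (p τ)) τ) :
    ∀ τ ∈ S,
      τ ^ 2 * (deriv (deriv (fun t => p t * q t / 2)) τ
          + 4 * Complex.I * ε * b) ^ 2
        = (4 * (p τ * q τ / 2) - ε₁ * (2 * Complex.I * a + 1)) ^ 2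
          * ((deriv (fun t => p t * q t / 2) τ) ^ 2
              + 8 * Complex.I * ε * b * (p τ * q τ / 2)) := by
  simp only [(hasDerivAt_Ham_fst _ _ _ _ _ _ _).deriv] at hq
  simp only [(hasDerivAt_Ham_snd _ _ _ _ _ _ _).deriv] at hp
  have hf : ∀ τ ∈ S, deriv (fun t => p t * q t / 2) τ
      = (Complex.I * b * p τ - 4 * ε * q τ) / 2 := by
    intro τ hτ
    rw [(((hp τ hτ).fun_mul (hq τ hτ)).div_const 2).deriv]
    ring
  intro τ hτ
  have hτ0 := (hne τ hτ).1
  have hf' : deriv (fun t => p t * q t / 2)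
      =ᶠ[nhds τ] fun t => (Complex.I * b * p t - 4 * ε * q t) / 2 :=
    Filter.eventually_of_mem (hS.mem_nhds hτ) hf
  rw [hf'.deriv_eq, hf τ hτ,
    ((((hp τ hτ).const_mul (Complex.I * b)).fun_sub
      ((hq τ hτ).const_mul (4 * ε))).div_const 2).deriv]
  field_simp
  ring
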